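/- arXiv:2404.06516 — 4 statements merged into one kernel-verified Lean document; each statement's English description precedes it below -/
import Mathlib

section
/- Frank–Wolfe descent step with an inexact gradient: let K ⊆ ℝ^d be a nonempty compact convex set with diameter at most R (i.e., ‖x − y‖₂ ≤ R for all x, y ∈ K), and let f : ℝ^d → ℝ be differentiable and L-smooth on K, meaning f(y) ≤ f(x) + ⟨∇f(x), y − x⟩ + (L/2)‖y − x‖₂² for all x, y ∈ K. Let x ∈ K, d ∈ ℝ^d, let x̂ ∈ K minimize y ↦ ⟨y, d⟩ over K, let η ∈ [0,1], and set x⁺ = (1 − η)x + η x̂. Then f(x⁺) ≤ f(x) − η G(x) + 2ηR ‖∇f(x) − d‖₂ + η² L R² / 2, where G(x) = max_{y∈K} ⟨x − y, ∇f(x)⟩. -/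
open scoped RealInnerProductSpace

noncomputable section

/-- Frank–Wolfe descent step with an inexact gradient.  With
`x⁺ = (1−η)x + η x̂` where `x̂` minimizes `⟨·, g⟩` over `K`, one has
`f(x⁺) ≤ f(x) − η G(x) + 2ηR‖∇f(x) − g‖ + η²LR²/2`, with
`G(x) = max_{y∈K} ⟨x − y, ∇f(x)⟩` the Frank–Wolfe gap. -/
theorem frankWolfe_descent_step (d : ℕ) (K : Set (EuclideanSpace ℝ (Fin d)))
    (hKcp : IsCompact K) (hKcv : Convex ℝ K) (hKne : K.Nonempty)
    (R : ℝ) (hR : ∀ x ∈ K, ∀ y ∈ K, ‖x - y‖ ≤ R)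
    (f : EuclideanSpace ℝ (Fin d) → ℝ) (L : ℝ) (hL : 0 ≤ L)
    (hdiff : ∀ x ∈ K, DifferentiableAt ℝ f x)
    (hsmooth : ∀ x ∈ K, ∀ y ∈ K,
      f y ≤ f x + ⟪gradient f x, y - x⟫ + L / 2 * ‖y - x‖ ^ 2)
    (x : EuclideanSpace ℝ (Fin d)) (hx : x ∈ K)
    (g : EuclideanSpace ℝ (Fin d))
    (xhat : EuclideanSpace ℝ (Fin d)) (hxhat : xhat ∈ K)
    (hmin : ∀ y ∈ K, ⟪xhat, g⟫ ≤ ⟪y, g⟫)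
    (η : ℝ) (hη : η ∈ Set.Icc (0 : ℝ) 1) :
    f ((1 - η) • x + η • xhat)
      ≤ f x - η * (⨆ y : K, ⟪x - (y : EuclideanSpace ℝ (Fin d)), gradient f x⟫)
        + 2 * η * R * ‖gradient f x - g‖ + η ^ 2 * L * R ^ 2 / 2 := by
  obtain ⟨hη0, hη1⟩ := hη
  have : Nonempty K := hKne.to_subtype
  have hR0 : 0 ≤ R := (norm_nonneg _).trans (hR x hx x hx)
  have hgap : (⨆ y : K, ⟪x - (y : EuclideanSpace ℝ (Fin d)), gradient f x⟫)
      ≤ ⟪x - xhat, gradient f x⟫ + R * ‖gradient f x - g‖ := by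
    refine ciSup_le fun ⟨y, hy⟩ => ?_
    have hcs : ⟪xhat - y, gradient f x - g⟫ ≤ R * ‖gradient f x - g‖ :=
      (real_inner_le_norm _ _).trans
        (mul_le_mul_of_nonneg_right (hR xhat hxhat y hy) (norm_nonneg _))
    have hy' := hmin y hy
    simp only [inner_sub_left, inner_sub_right] at hcs ⊢
    linarith
  have hmem : (1 - η) • x + η • xhat ∈ K :=
    hKcv hx hxhat (by linarith) hη0 (by ring)
  have hstep : (1 - η) • x + η • xhat - x = η • (xhat - x) := by module
  have hdescent := hsmooth x hx _ hmem
  rw [hstep, inner_smul_right, norm_smul, Real.norm_of_nonneg hη0, mul_pow,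
    real_inner_comm, ← neg_sub x xhat, inner_neg_left, norm_neg] at hdescent
  have hquad : L / 2 * (η ^ 2 * ‖x - xhat‖ ^ 2) ≤ L / 2 * (η ^ 2 * R ^ 2) := by
    have := hR x hx xhat hxhat
    gcongr
  have hgap' := mul_le_mul_of_nonneg_left hgap hη0
  have herr : 0 ≤ η * (R * ‖gradient f x - g‖) := by positivity
  linarith
end
end

section
/- Cumulative Frank–Wolfe gap bound for the inexact-gradient Frank–Wolfe iteration: let K ⊆ ℝ^d be a nonempty compact convex set with diameter at most R, and f : ℝ^d → ℝ differentiable, L-smooth on K (f(y) ≤ f(x) + ⟨∇f(x), y−x⟩ + (L/2)‖y−x‖₂² for x,y ∈ K), with 0 ≤ f(x) ≤ B for all x ∈ K. Let η_1 ≥ ⋯ ≥ η_{T+1} > 0 with η_t ≤ 1, let d_1, …, d_T ∈ ℝ^d, and let x_1 ∈ K and for t = 1, …, T set x̂_{t+1} ∈ argmin_{y∈K} ⟨y, d_t⟩ and x_{t+1} = (1 − η_t)x_t + η_t x̂_{t+1}. Then Σ_{t=1}^T G(x_t) ≤ 2B/η_{T+1} + 2R Σ_{t=1}^T ‖∇f(x_t)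 − d_t‖₂ + (L R² / 2) Σ_{t=1}^T η_t, where G(x) = max_{y∈K} ⟨x − y, ∇f(x)⟩. -/
open scoped RealInnerProductSpace

noncomputable section

/-- Abel-type bound: for a sequence `a ≤ B` and positive nonincreasing weights `η`, the weighted
decrements of `a` telescope up to the last weight. -/
lemma sum_sub_succ_div_le (a η : ℕ → ℝ) (B : ℝ) (n : ℕ)
    (ha : ∀ t ∈ Finset.Icc 1 (n + 1), a t ≤ B)
    (hη : ∀ t ∈ Finset.Icc 1 (n + 1), 0 < η t)
    (hmono : ∀ t ∈ Finset.Icc 1 n, η (t + 1) ≤ η t) :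
    ∑ t ∈ Finset.Icc 1 n, (a t - a (t + 1)) / η t ≤ (B - a (n + 1)) / η (n + 1) := by
  induction n with
  | zero =>
    have h1 := ha 1 (by simp)
    have h2 := hη 1 (by simp)
    simpa using div_nonneg (sub_nonneg.2 h1) h2.le
  | succ n ih =>
    simp only [Finset.mem_Icc] at ha hη hmono ih
    have h := ih (fun t ht => ha t (by lia)) (fun t ht => hη t (by lia))
      (fun t ht => hmono t (by lia))
    rw [Finset.sum_Icc_succ_top (by lia)]
    calc _ ≤ (B - a (n + 1)) / η (n + 1) + (a (n + 1) - a (n + 1 + 1)) / η (n + 1) := by gcongr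
      _ = (B - a (n + 1 + 1)) / η (n + 1) := by ring
      _ ≤ (B - a (n + 1 + 1)) / η (n + 1 + 1) :=
        div_le_div_of_nonneg_left (sub_nonneg.2 (ha _ (by lia))) (hη _ (by lia))
          (hmono _ (by lia))

/-- One-step bound: a Frank–Wolfe step from `x` towards a minimizer `z` of `⟪·, g⟫`, with
`v` in the role of the gradient at `x`, controls `⟪x - y, v⟫` by the decrease of the objective
(from `a` to `b`) and the error `‖v - g‖`. -/
lemma inner_sub_le_of_frankWolfe_step {E : Type*} [NormedAddCommGroup E] [InnerProductSpace ℝ E]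
    {x y z g v : E} {a b L R η : ℝ} (hL : 0 ≤ L) (hη : 0 < η)
    (hxz : ‖z - x‖ ≤ R) (hyz : ‖z - y‖ ≤ R) (hmin : ⟪z, g⟫ ≤ ⟪y, g⟫)
    (hdesc : b ≤ a + ⟪v, η • (z - x)⟫ + L / 2 * ‖η • (z - x)‖ ^ 2) :
    ⟪x - y, v⟫ ≤ (a - b) / η + R * ‖v - g‖ + L * R ^ 2 / 2 * η := by
  have hsplit : ⟪x - y, v⟫ = -⟪v, z - x⟫ + (⟪z, g⟫ - ⟪y, g⟫) + ⟪z - y, v - g⟫ := by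
    rw [real_inner_comm]
    simp only [inner_sub_left, inner_sub_right, real_inner_comm v]
    ring
  have herr : ⟪z - y, v - g⟫ ≤ R * ‖v - g‖ :=
    (real_inner_le_norm _ _).trans (by gcongr)
  have hsq : L / 2 * ‖η • (z - x)‖ ^ 2 ≤ L / 2 * (η ^ 2 * R ^ 2) := by
    rw [norm_smul, Real.norm_of_nonneg hη.le, mul_pow]
    gcongr
  rw [inner_smul_right] at hdesc
  have hmain : -⟪v, z - x⟫ ≤ (a - b) / η + L * R ^ 2 / 2 * η := by
    rw [← sub_le_iff_le_add, le_div_iff₀ hη]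
    linarith
  linarith

/-- cumulative Frank–Wolfe gap bound for the inexact-gradient
Frank–Wolfe iteration `x̂_{t+1} ∈ argmin_{y∈K} ⟨y, g_t⟩`,
`x_{t+1} = (1−η_t)x_t + η_t x̂_{t+1}`:
`Σ_t G(x_t) ≤ 2B/η_{T+1} + 2R Σ_t ‖∇f(x_t) − g_t‖ + (LR²/2) Σ_t η_t`. -/
theorem frankWolfe_cumulative_gap_bound (d T : ℕ) (hT : 1 ≤ T)
    (K : Set (EuclideanSpace ℝ (Fin d)))
    (hKcp : IsCompact K) (hKcv : Convex ℝ K) (hKne : K.Nonempty)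
    (R : ℝ) (hR : ∀ x ∈ K, ∀ y ∈ K, ‖x - y‖ ≤ R)
    (f : EuclideanSpace ℝ (Fin d) → ℝ) (L : ℝ) (hL : 0 ≤ L)
    (hdiff : ∀ x ∈ K, DifferentiableAt ℝ f x)
    (hsmooth : ∀ x ∈ K, ∀ y ∈ K,
      f y ≤ f x + ⟪gradient f x, y - x⟫ + L / 2 * ‖y - x‖ ^ 2)
    (B : ℝ) (hfB : ∀ x ∈ K, 0 ≤ f x ∧ f x ≤ B)
    (η : ℕ → ℝ)
    (hmono : ∀ t ∈ Finset.Icc 1 T, η (t + 1) ≤ η t)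
    (hpos : 0 < η (T + 1)) (hle1 : ∀ t ∈ Finset.Icc 1 T, η t ≤ 1)
    (g x xhat : ℕ → EuclideanSpace ℝ (Fin d))
    (hx1 : x 1 ∈ K)
    (hhatK : ∀ t ∈ Finset.Icc 1 T, xhat (t + 1) ∈ K)
    (hhatMin : ∀ t ∈ Finset.Icc 1 T, ∀ y ∈ K, ⟪xhat (t + 1), g t⟫ ≤ ⟪y, g t⟫)
    (hupd : ∀ t ∈ Finset.Icc 1 T, x (t + 1) = (1 - η t) • x t + η t • xhat (t + 1)) :
    ∑ t ∈ Finset.Icc 1 T,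
        (⨆ y : K, ⟪x t - (y : EuclideanSpace ℝ (Fin d)), gradient f (x t)⟫)
      ≤ 2 * B / η (T + 1)
        + 2 * R * ∑ t ∈ Finset.Icc 1 T, ‖gradient f (x t) - g t‖
        + L * R ^ 2 / 2 * ∑ t ∈ Finset.Icc 1 T, η t := by
  have hanti : ∀ t ∈ Finset.Icc 1 (T + 1), η (T + 1) ≤ η t := by
    intro t ht
    rw [Finset.mem_Icc] at ht
    exact Nat.decreasingInduction' (P := fun k => η (T + 1) ≤ η k)
      (fun k hk htk h => h.trans (hmono k (Finset.mem_Icc.2 (by lia)))) ht.2 le_rfl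
  have hη : ∀ t ∈ Finset.Icc 1 (T + 1), 0 < η t := fun t ht => hpos.trans_le (hanti t ht)
  have hη' : ∀ t ∈ Finset.Icc 1 T, 0 < η t := fun t ht =>
    hη t (Finset.Icc_subset_Icc_right T.le_succ ht)
  have hxK : ∀ t ∈ Finset.Icc 1 (T + 1), x t ∈ K := by
    intro t ht
    rw [Finset.mem_Icc] at ht
    obtain ⟨h1, h2⟩ := ht
    induction t, h1 using Nat.le_induction with
    | base => exact hx1
    | succ t h1 ih =>
      have ht : t ∈ Finset.Icc 1 T := Finset.mem_Icc.2 (by lia)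
      rw [hupd t ht]
      exact hKcv (ih (by lia)) (hhatK t ht) (sub_nonneg.2 (hle1 t ht)) (hη' t ht).le (by ring)
  have hxK' : ∀ t ∈ Finset.Icc 1 T, x t ∈ K := fun t ht =>
    hxK t (Finset.Icc_subset_Icc_right T.le_succ ht)
  have hxK'' : ∀ t ∈ Finset.Icc 1 T, x (t + 1) ∈ K := fun t ht =>
    hxK (t + 1) (by rw [Finset.mem_Icc] at ht ⊢; lia)
  have hR0 : 0 ≤ R := (norm_nonneg _).trans (hR _ hx1 _ hx1)
  have hB0 : 0 ≤ B := (hfB _ hx1).1.trans (hfB _ hx1).2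
  have : Nonempty K := hKne.to_subtype
  have hgap : ∀ t ∈ Finset.Icc 1 T,
      (⨆ y : K, ⟪x t - (y : EuclideanSpace ℝ (Fin d)), gradient f (x t)⟫)
        ≤ (f (x t) - f (x (t + 1))) / η t + R * ‖gradient f (x t) - g t‖
          + L * R ^ 2 / 2 * η t := by
    intro t ht
    refine ciSup_le fun y => ?_
    have hstep : x (t + 1) - x t = η t • (xhat (t + 1) - x t) := by
      rw [hupd t ht]
      module
    refine inner_sub_le_of_frankWolfe_step hL (hη' t ht) (hR _ (hhatK t ht) _ (hxK' t ht))
      (hR _ (hhatK t ht) _ y.2) (hhatMin t ht y y.2) ?_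
    rw [← hstep]
    exact hsmooth _ (hxK' t ht) _ (hxK'' t ht)
  have htel := sum_sub_succ_div_le (fun t => f (x t)) η B T (fun t ht => (hfB _ (hxK t ht)).2)
    hη hmono
  have hlast : (B - f (x (T + 1))) / η (T + 1) ≤ 2 * B / η (T + 1) := by
    have := (hfB _ (hxK (T + 1) (by simp))).1
    gcongr
    linarith
  have herr : 0 ≤ R * ∑ t ∈ Finset.Icc 1 T, ‖gradient f (x t) - g t‖ := by positivity
  have hsum := Finset.sum_le_sum hgap
  rw [Finset.sum_add_distrib, Finset.sum_add_distrib, ← Finset.mul_sum, ← Finset.mul_sum] at hsum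
  linarith
end
end

section
/- Recursive-estimator error decay (sequence form underlying Lemma 2): let α ∈ (0,1], ρ₀ ≥ 4, D ≥ 0, and let (a_t)_{t≥1} be nonnegative reals satisfying a_t ≤ (1 − ρ₀/(2 t^α)) a_{t−1} + D / t^{2α} for all t ≥ 2. Then for every t ≥ 1, a_t ≤ max{2^α a_1, D} / (t+1)^α. -/
/-- recursive-estimator error decay.  If `α ∈ (0,1]`, `ρ₀ ≥ 4`, `D ≥ 0`
and the nonnegative sequence `a` satisfies
`a_t ≤ (1 − ρ₀/(2 t^α)) a_{t−1} + D / t^{2α}` for all `t ≥ 2`, then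
`a_t ≤ max{2^α a_1, D} / (t+1)^α` for all `t ≥ 1`. -/
theorem recursive_estimator_error_decay
    (α : ℝ) (hα : α ∈ Set.Ioc (0 : ℝ) 1)
    (ρ₀ : ℝ) (hρ : 4 ≤ ρ₀) (D : ℝ) (hD : 0 ≤ D)
    (a : ℕ → ℝ) (ha : ∀ t : ℕ, 1 ≤ t → 0 ≤ a t)
    (hrec : ∀ t : ℕ, 2 ≤ t →
      a t ≤ (1 - ρ₀ / (2 * (t : ℝ) ^ α)) * a (t - 1) + D / (t : ℝ) ^ (2 * α)) :
    ∀ t : ℕ, 1 ≤ t → a t ≤ max ((2 : ℝ) ^ α * a 1) D / ((t : ℝ) + 1) ^ α := by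
  obtain ⟨hα0, hα1⟩ := hα
  set M := max ((2 : ℝ) ^ α * a 1) D
  have hDM : D ≤ M := le_max_right _ _
  have hM0 : 0 ≤ M := hD.trans hDM
  intro t ht
  induction t, ht using Nat.le_induction with
  | base =>
    have h2 : (((1 : ℕ) : ℝ) + 1) ^ α = (2 : ℝ) ^ α := by norm_num
    rw [h2, le_div_iff₀ (by positivity), mul_comm]
    exact le_max_left _ _
  | succ n hn ih =>
    have hr := hrec (n + 1) (by omega)
    have hn0 := ha n hn
    rw [Nat.add_sub_cancel] at hr
    push_cast at hr ⊢
    have hnR : (1 : ℝ) ≤ n := by exact_mod_cast hn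
    have hsq : ((n : ℝ) + 1) ^ (2 * α) = (((n : ℝ) + 1) ^ α) ^ 2 := by
      rw [← Real.rpow_mul_natCast (by positivity)]
      ring_nf
    have hsub : ((n : ℝ) + 1 + 1) ^ α ≤ ((n : ℝ) + 1) ^ α + 1 := by
      simpa using Real.rpow_add_le_add_rpow (p := α) (by positivity : (0 : ℝ) ≤ n + 1)
        zero_le_one hα0.le hα1
    have hle_sq : ((n : ℝ) + 1 + 1) ^ α ≤ (((n : ℝ) + 1) ^ α) ^ 2 := by
      rw [← hsq, Real.rpow_mul (by positivity)]
      refine Real.rpow_le_rpow (by positivity) ?_ hα0.le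
      norm_num
      nlinarith
    rw [hsq] at hr
    have hx : 0 < ((n : ℝ) + 1) ^ α := by positivity
    have hy : 0 < ((n : ℝ) + 1 + 1) ^ α := by positivity
    set x := ((n : ℝ) + 1) ^ α
    set y := ((n : ℝ) + 1 + 1) ^ α
    have hcoef : 1 - ρ₀ / (2 * x) ≤ 1 - 2 / x := by
      have : 2 / x ≤ ρ₀ / (2 * x) := by
        rw [div_le_div_iff₀ hx (by positivity)]
        nlinarith
      linarith
    have hD' : D / x ^ 2 ≤ M / x ^ 2 := by gcongr
    have hstep : a (n + 1) ≤ (1 - 2 / x) * a n + M / x ^ 2 :=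
      hr.trans (add_le_add (mul_le_mul_of_nonneg_right hcoef hn0) hD')
    rcases le_total 0 (1 - 2 / x) with hc | hc
    · calc a (n + 1) ≤ (1 - 2 / x) * (M / x) + M / x ^ 2 :=
            hstep.trans (by gcongr)
        _ = M * (x - 1) / x ^ 2 := by field_simp; ring
        _ ≤ M / y := by
          rw [div_le_div_iff₀ (by positivity) hy, mul_assoc]
          refine mul_le_mul_of_nonneg_left ?_ hM0
          have hx2 : 2 ≤ x := by
            rw [sub_nonneg, div_le_one hx] at hc
            exact hc
          nlinarith
    · calc a (n + 1) ≤ M / x ^ 2 := by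
            linarith [mul_nonpos_of_nonpos_of_nonneg hc hn0]
        _ ≤ M / y := by gcongr
end

section
/- Contraction-plus-noise decay at rate t^{−1/5} (sequence form underlying Theorem 2): let γ ∈ [2/5, 1], D ≥ 0, and let (a_t)_{t≥1} be nonnegative reals satisfying a_{t+1} ≤ (1 − γ / t^{4/5}) a_t + D / t for all t ≥ 1. Then for every t ≥ 1, a_t ≤ max{a_1, 2D/γ} / t^{1/5}. -/
/-- A discrete version of the derivative bound for the fifth root: if `u ^ 5 = s ^ 5 + 1` with
`s ≥ 1`, then `(1 - 1 / (5 s ^ 4)) / s ≤ 1 / u`. -/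
theorem one_sub_div_le_inv_of_pow_five_eq {s u : ℝ} (hs : 1 ≤ s) (hu : 0 < u)
    (h : u ^ 5 = s ^ 5 + 1) : (1 - 1 / (5 * s ^ 4)) / s ≤ 1 / u := by
  have hs0 : 0 < s := by linarith
  have hx : 0 < 1 / (5 * s ^ 4) := by positivity
  set x := 1 / (5 * s ^ 4) with hxdef
  have hxs : x * s ^ 4 = 1 / 5 := by rw [hxdef]; field_simp
  have hx1 : x ≤ 1 := by
    nlinarith [mul_le_mul_of_nonneg_left (one_le_pow₀ hs (n := 4)) hx.le]
  have hus : u ≤ s + x := by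
    refine le_of_pow_le_pow_left₀ (n := 5) (by norm_num) (by positivity) ?_
    have : 0 ≤ 10 * s ^ 3 * x ^ 2 + 10 * s ^ 2 * x ^ 3 + 5 * s * x ^ 4 + x ^ 5 := by positivity
    rw [h]
    linarith [show (s + x) ^ 5 = s ^ 5 + 5 * (x * s ^ 4)
      + (10 * s ^ 3 * x ^ 2 + 10 * s ^ 2 * x ^ 3 + 5 * s * x ^ 4 + x ^ 5) by ring]
  rw [div_le_div_iff₀ hs0 hu]
  nlinarith [mul_le_mul_of_nonneg_left hus (sub_nonneg.2 hx1), mul_nonneg hx.le (sub_nonneg.2 hs)]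

/-- contraction-plus-noise decay at rate `t^{−1/5}`.  If `γ ∈ [2/5, 1]`,
`D ≥ 0` and the nonnegative sequence `a` satisfies
`a_{t+1} ≤ (1 − γ/t^{4/5}) a_t + D/t` for all `t ≥ 1`, then
`a_t ≤ max{a_1, 2D/γ} / t^{1/5}` for all `t ≥ 1`. -/
theorem contraction_plus_noise_decay
    (γ : ℝ) (hγ : γ ∈ Set.Icc (2 / 5 : ℝ) 1) (D : ℝ) (hD : 0 ≤ D)
    (a : ℕ → ℝ) (ha : ∀ t : ℕ, 1 ≤ t → 0 ≤ a t)
    (hrec : ∀ t : ℕ, 1 ≤ t →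
      a (t + 1) ≤ (1 - γ / (t : ℝ) ^ ((4 : ℝ) / 5)) * a t + D / (t : ℝ)) :
    ∀ t : ℕ, 1 ≤ t → a t ≤ max (a 1) (2 * D / γ) / (t : ℝ) ^ ((1 : ℝ) / 5) := by
  obtain ⟨hγl, hγu⟩ := hγ
  have hγ0 : 0 < γ := by linarith
  intro t ht
  set C := max (a 1) (2 * D / γ)
  have hC0 : 0 ≤ C := (ha 1 le_rfl).trans (le_max_left _ _)
  have hDC : D ≤ C * γ / 2 := by
    have h : 2 * D / γ ≤ C := le_max_right _ _
    rw [div_le_iff₀ hγ0] at h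
    linarith
  induction t, ht using Nat.le_induction with
  | base =>
    rw [Nat.cast_one, Real.one_rpow, div_one]
    exact le_max_left _ _
  | succ t ht ih =>
    have ht1 : (1 : ℝ) ≤ t := by exact_mod_cast ht
    have ht0 : (0 : ℝ) ≤ t := by linarith
    have hstep := hrec t ht
    have h4 : (t : ℝ) ^ ((4 : ℝ) / 5) = ((t : ℝ) ^ ((1 : ℝ) / 5)) ^ 4 := by
      rw [← Real.rpow_mul_natCast ht0]; norm_num
    have h5 : ((t : ℝ) ^ ((1 : ℝ) / 5)) ^ 5 = t := by
      rw [← Real.rpow_mul_natCast ht0]; norm_num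
    have hu5 : (((t + 1 : ℕ) : ℝ) ^ ((1 : ℝ) / 5)) ^ 5 = (t : ℝ) + 1 := by
      rw [← Real.rpow_mul_natCast (by positivity)]; norm_num
    have hs : 1 ≤ (t : ℝ) ^ ((1 : ℝ) / 5) := Real.one_le_rpow ht1 (by norm_num)
    have hu : 0 < ((t + 1 : ℕ) : ℝ) ^ ((1 : ℝ) / 5) := by positivity
    rw [h4] at hstep
    set s := (t : ℝ) ^ ((1 : ℝ) / 5)
    set u := ((t + 1 : ℕ) : ℝ) ^ ((1 : ℝ) / 5)
    have hs0 : 0 < s := by linarith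
    have hcoef : 0 ≤ 1 - γ / s ^ 4 := by
      rw [sub_nonneg, div_le_one (by positivity)]
      exact hγu.trans (one_le_pow₀ hs)
    calc a (t + 1) ≤ (1 - γ / s ^ 4) * a t + D / t := hstep
      _ ≤ (1 - γ / s ^ 4) * (C / s) + (C * γ / 2) / t := by gcongr
      _ = C * ((1 - (γ / 2) / s ^ 4) / s) := by rw [← h5]; field_simp; ring
      _ ≤ C * ((1 - (1 / 5) / s ^ 4) / s) := by
        have : 1 / 5 ≤ γ / 2 := by linarith
        gcongr
      _ = C * ((1 - 1 / (5 * s ^ 4)) / s) := by rw [div_div]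
      _ ≤ C * (1 / u) := by
        refine mul_le_mul_of_nonneg_left ?_ hC0
        exact one_sub_div_le_inv_of_pow_five_eq hs hu (by rw [hu5, h5])
      _ = C / u := by rw [mul_one_div]
end
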